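/- arXiv:2305.03560 — 2 statements merged into one kernel-verified Lean document; each statement's English description precedes it below -/
import Mathlib

section
/- Let λ > 0 and c ≥ 0 be constants, and let (W_N)_{N≥2} be random variables such that 0 ≤ W_N ≤ c/N almost surely for every N, and N·W_N → λ almost surely as N → ∞. Then E[ (N(N−1)/2) · (1 − W_N)^{N−2} · W_N² ] converges to (λ²/2) e^{−λ} as N → ∞. -/
open MeasureTheory ProbabilityTheory Filter

/-- If `N * x N → l`, then `(N(N-1)/2) (1 - x N)^(N-2) (x N)^2 → (l^2/2) e^(-l)`. -/
theorem tendsto_choose_two_mul_one_sub_pow_mul_sq {x : ℕ → ℝ} {l : ℝ}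
    (hx : Tendsto (fun N : ℕ => (N : ℝ) * x N) atTop (nhds l)) :
    Tendsto (fun N : ℕ => ((N : ℝ) * ((N : ℝ) - 1) / 2) * (1 - x N) ^ (N - 2) * (x N) ^ 2)
      atTop (nhds (l ^ 2 / 2 * Real.exp (-l))) := by
  have hinv : Tendsto (fun N : ℕ => ((N : ℝ))⁻¹) atTop (nhds 0) :=
    tendsto_inv_atTop_nhds_zero_nat
  have hx0 : Tendsto x atTop (nhds 0) := by
    have h := hinv.mul hx
    rw [zero_mul] at h
    refine h.congr' ?_
    filter_upwards [eventually_ge_atTop 1] with N hN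
    have : (N : ℝ) ≠ 0 := by positivity
    field_simp
  have hpow : Tendsto (fun N : ℕ => (1 + -x N) ^ N) atTop (nhds (Real.exp (-l))) :=
    Real.tendsto_one_add_pow_exp_of_tendsto (by simpa using hx.neg)
  have hone : Tendsto (fun N : ℕ => 1 - x N) atTop (nhds 1) := by
    simpa using hx0.const_sub 1
  have hfac : Tendsto (fun N : ℕ => 1 - ((N : ℝ))⁻¹) atTop (nhds 1) := by
    simpa using hinv.const_sub 1
  have h := (((hx.pow 2).div_const 2).mul hfac).mul (hpow.div (hone.pow 2) (by norm_num))
  simp only [one_pow, div_one, mul_one] at h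
  refine h.congr' ?_
  filter_upwards [eventually_ge_atTop 2, hone.eventually_ne one_ne_zero] with N hN hne
  obtain ⟨k, rfl⟩ := Nat.exists_eq_add_of_le' hN
  have : ((k + 2 : ℕ) : ℝ) ≠ 0 := by positivity
  rw [Pi.div_apply, ← sub_eq_add_neg, Nat.add_sub_cancel, pow_add,
    mul_div_cancel_right₀ _ (pow_ne_zero 2 hne)]
  field_simp

/-- If `0 ≤ x ≤ c/N`, then `(N(N-1)/2) (1 - x)^(N-2) x^2` is at most `c^2/2` in absolute value,
as soon as `N ≥ max 1 c`. -/
theorem norm_choose_two_mul_one_sub_pow_mul_sq_le {N : ℕ} {x c : ℝ} (hN : 1 ≤ N) (hcN : c ≤ N)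
    (hx : 0 ≤ x) (hxc : x ≤ c / N) :
    ‖((N : ℝ) * ((N : ℝ) - 1) / 2) * (1 - x) ^ (N - 2) * x ^ 2‖ ≤ c ^ 2 / 2 := by
  have hN1 : (1 : ℝ) ≤ N := by exact_mod_cast hN
  have hN0 : (0 : ℝ) < N := by linarith
  have hx1 : x ≤ 1 := hxc.trans ((div_le_one hN0).2 hcN)
  have hNx : N * x ≤ c := by rwa [le_div_iff₀' hN0] at hxc
  have hp0 : 0 ≤ (1 - x) ^ (N - 2) := pow_nonneg (by linarith) _
  have hp1 : (1 - x) ^ (N - 2) ≤ 1 := pow_le_one₀ (by linarith) (by linarith)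
  have hA : 0 ≤ (N : ℝ) * ((N : ℝ) - 1) / 2 :=
    div_nonneg (mul_nonneg hN0.le (by linarith)) zero_le_two
  rw [Real.norm_of_nonneg (by positivity)]
  calc ((N : ℝ) * ((N : ℝ) - 1) / 2) * (1 - x) ^ (N - 2) * x ^ 2
      ≤ ((N : ℝ) * N / 2) * 1 * x ^ 2 := by gcongr; linarith
    _ = (N * x) ^ 2 / 2 := by ring
    _ ≤ c ^ 2 / 2 := by gcongr

/-- If `0 ≤ W N ≤ c/N` a.s. for every `N ≥ 2` and `N * W N → lam > 0`
a.s., then `E[(N(N-1)/2) (1 - W N)^(N-2) (W N)^2] → (lam^2/2) e^(-lam)`. -/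
theorem statement8
    {Ω : Type*} [MeasureSpace Ω] [IsProbabilityMeasure (ℙ : Measure Ω)]
    (lam c : ℝ) (hlam : 0 < lam) (hc : 0 ≤ c)
    (W : ℕ → Ω → ℝ) (hWmeas : ∀ N, Measurable (W N))
    (hWbdd : ∀ N : ℕ, 2 ≤ N → ∀ᵐ ω, 0 ≤ W N ω ∧ W N ω ≤ c / N)
    (hWconv : ∀ᵐ ω, Tendsto (fun N : ℕ => (N : ℝ) * W N ω) atTop (nhds lam)) :
    Tendsto
      (fun N : ℕ => ∫ ω, ((N : ℝ) * ((N : ℝ) - 1) / 2) * (1 - W N ω) ^ (N - 2) * (W N ω) ^ 2)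
      atTop (nhds (lam ^ 2 / 2 * Real.exp (-lam))) := by
  have hlim : ∫ _ : Ω, lam ^ 2 / 2 * Real.exp (-lam) = lam ^ 2 / 2 * Real.exp (-lam) := by
    simp
  rw [← hlim]
  refine tendsto_integral_filter_of_dominated_convergence (fun _ => c ^ 2 / 2) ?_ ?_
    (integrable_const _) ?_
  · refine Eventually.of_forall fun N => Measurable.aestronglyMeasurable ?_
    have := hWmeas N
    fun_prop
  · filter_upwards [eventually_ge_atTop 2, eventually_ge_atTop ⌈c⌉₊] with N hN hcN
    filter_upwards [hWbdd N hN] with ω hω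
    exact norm_choose_two_mul_one_sub_pow_mul_sq_le (one_le_two.trans hN) (Nat.ceil_le.1 hcN)
      hω.1 hω.2
  · filter_upwards [hWconv] with ω hω
    exact tendsto_choose_two_mul_one_sub_pow_mul_sq hω
end

section
/- For reals 0 < p_b < p_a and α ∈ (0,1), set q_a = p_a/(α p_a + (1−α) p_b), q_b = p_b/(α p_a + (1−α) p_b), q_a' = p_a/(α p_a q_a + (1−α) p_b q_b), q_b' = p_b/(α p_a q_a + (1−α) p_b q_b), f(x) = (x²/2) e^{−x}, and define R(α, p_a, p_b) = (1/(α q_a)) · ( α f(q_a) / (α f(q_a) + (1−α) f(q_b)) ) · ( α q_a f(q_a') / (α q_a f(q_a') + (1−α) q_b f(q_b')) ). Then R(1/2, 1, 3/40) > 1. -/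
/-- `f(x) = (x^2/2) e^(-x)`. -/
noncomputable def f (x : ℝ) : ℝ := x ^ 2 / 2 * Real.exp (-x)

/-- `q_a = p_a / (α p_a + (1-α) p_b)`. -/
noncomputable def qa (α pa pb : ℝ) : ℝ := pa / (α * pa + (1 - α) * pb)

/-- `q_b = p_b / (α p_a + (1-α) p_b)`. -/
noncomputable def qb (α pa pb : ℝ) : ℝ := pb / (α * pa + (1 - α) * pb)

/-- `q_a' = p_a / (α p_a q_a + (1-α) p_b q_b)`. -/
noncomputable def qa' (α pa pb : ℝ) : ℝ :=
  pa / (α * pa * qa α pa pb + (1 - α) * pb * qb α pa pb)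

/-- `q_b' = p_b / (α p_a q_a + (1-α) p_b q_b)`. -/
noncomputable def qb' (α pa pb : ℝ) : ℝ :=
  pb / (α * pa * qa α pa pb + (1 - α) * pb * qb α pa pb)

/-- `R(α, p_a, p_b)` from Theorem `main` of the paper. -/
noncomputable def R (α pa pb : ℝ) : ℝ :=
  (1 / (α * qa α pa pb)) *
    (α * f (qa α pa pb) / (α * f (qa α pa pb) + (1 - α) * f (qb α pa pb))) *
    (α * qa α pa pb * f (qa' α pa pb) /
      (α * qa α pa pb * f (qa' α pa pb) + (1 - α) * qb α pa pb * f (qb' α pa pb)))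

/-- A shift of the argument by at most `n` costs a factor of at most `3 ^ n`. -/
lemma exp_le_three_pow_mul_exp {x y : ℝ} (n : ℕ) (h : x ≤ n + y) :
    Real.exp x ≤ 3 ^ n * Real.exp y := by
  calc Real.exp x ≤ Real.exp (n * 1 + y) := Real.exp_le_exp.mpr (by simpa using h)
    _ = Real.exp 1 ^ n * Real.exp y := by rw [Real.exp_add, Real.exp_nat_mul]
    _ ≤ 3 ^ n * Real.exp y := by
      gcongr
      exact Real.exp_one_lt_three.le

/-- A lower bound `c / (c + d) ≤ u / (u + v)` from a bound on the ratio `v / u`. -/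
lemma div_add_le_div_add {c d u v : ℝ} (hc : 0 < c) (hd : 0 < d) (hu : 0 < u) (hv : 0 < v)
    (h : c * v ≤ d * u) : c / (c + d) ≤ u / (u + v) := by
  rw [div_le_div_iff₀ (by positivity) (by positivity)]
  linarith

/-- `R(1/2, 1, 3/40) > 1`. -/
theorem statement11 : R (1/2) 1 (3/40) > 1 := by
  have hqa : qa (1/2) 1 (3/40) = 80/43 := by norm_num [qa]
  have hqb : qb (1/2) 1 (3/40) = 6/43 := by norm_num [qb]
  have hqa' : qa' (1/2) 1 (3/40) = 1720/1609 := by norm_num [qa', hqa, hqb]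
  have hqb' : qb' (1/2) 1 (3/40) = 129/1609 := by norm_num [qb', hqa, hqb]
  have h₁ : Real.exp (-(6/43)) ≤ 3 ^ 2 * Real.exp (-(80/43)) :=
    exp_le_three_pow_mul_exp 2 (by norm_num)
  have h₂ : Real.exp (-(129/1609)) ≤ 3 ^ 1 * Real.exp (-(1720/1609)) :=
    exp_le_three_pow_mul_exp 1 (by norm_num)
  simp only [R, hqa, hqb, hqa', hqb', f]
  have first_factor := div_add_le_div_add (c := 1600) (d := 81)
    (u := 1/2 * ((80/43) ^ 2 / 2 * Real.exp (-(80/43))))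
    (v := (1 - 1/2) * ((6/43) ^ 2 / 2 * Real.exp (-(6/43))))
    (by norm_num) (by norm_num) (by positivity)
    (mul_pos (by norm_num) (by positivity)) (by linarith)
  have second_factor := div_add_le_div_add (c := 64000) (d := 81)
    (u := 1/2 * (80/43) * ((1720/1609) ^ 2 / 2 * Real.exp (-(1720/1609))))
    (v := (1 - 1/2) * (6/43) * ((129/1609) ^ 2 / 2 * Real.exp (-(129/1609))))
    (by norm_num) (by norm_num) (by positivity)
    (mul_pos (by norm_num) (by positivity)) (by linarith)
  calc (1 : ℝ) < 1 / (1/2 * (80/43)) * (1600 / (1600 + 81)) * (64000 / (64000 + 81)) := by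
        norm_num
    _ ≤ _ := by gcongr
end
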